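/- For every natural number n, μ̃_n = ∑_{k=0}^{n} binom(n+k, 2k) · c^{n−k} · b^k · C_k. -/

import Mathlib

/-- The sum `∑_{k ≤ n} C(n+k, 2k) c^(n-k) b^k Catalan(k)`. -/
def catalanMoment {R : Type*} [CommRing R] (b c : R) (n : ℕ) : R :=
  ∑ k ∈ Finset.range (n + 1),
    ((n + k).choose (2 * k) : R) * c ^ (n - k) * b ^ k * (catalan k : R)

section PowerSeries

open PowerSeries

variable {R : Type*} [CommRing R]

theorem coeff_geometric_pow (c : R) (d n : ℕ) :
    coeff n ((mk fun i => c ^ i : R⟦X⟧) ^ (d + 1)) = (d + n).choose d * c ^ n := by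
  have h : (mk fun i => c ^ i : R⟦X⟧) = rescale c (mk 1) := by
    rw [rescale_mk]
    simp
  rw [h, ← map_pow, mk_one_pow_eq_mk_choose_add, coeff_rescale, coeff_mk, mul_comm]

theorem geometric_mul_one_sub (c : R) :
    (mk fun i => c ^ i : R⟦X⟧) * (1 - C c * X) = 1 := by
  have h := congrArg (rescale c) (mk_one_mul_one_sub_eq_one R)
  rw [map_mul, rescale_mk, map_sub, map_one, rescale_X] at h
  simpa using h

theorem mk_catalanMoment_eq_subst (b c : R)
    (ha : HasSubst (C b * X * (mk fun i => c ^ i : R⟦X⟧) ^ 2)) :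
    mk (catalanMoment b c) = (mk fun i => c ^ i : R⟦X⟧) *
      substAlgHom ha (PowerSeries.map (Nat.castRingHom R) catalanSeries) := by
  ext n
  rw [eq_X_pow_mul_shift_add_trunc (n + 1) (PowerSeries.map (Nat.castRingHom R) catalanSeries),
    map_add (substAlgHom ha), map_mul (substAlgHom ha), map_pow (substAlgHom ha), substAlgHom_X,
    substAlgHom_coe, mul_add, map_add]
  set U : R⟦X⟧ := mk fun i => c ^ i with hU
  set A : R⟦X⟧ := PowerSeries.map (Nat.castRingHom R) catalanSeries with hA
  have h0 (B : R⟦X⟧) : coeff n (U * ((C b * X * U ^ 2) ^ (n + 1) * B)) = 0 := by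
    have : U * ((C b * X * U ^ 2) ^ (n + 1) * B)
        = X ^ (n + 1) * (U * (C b * U ^ 2) ^ (n + 1) * B) := by ring
    rw [this, coeff_X_pow_mul', if_neg (by omega)]
  rw [h0, zero_add, trunc_apply, map_sum, Finset.mul_sum, map_sum, coeff_mk, catalanMoment,
    Nat.Ico_zero_eq_range]
  refine Finset.sum_congr rfl fun k hk => ?_
  have hk : k ≤ n := by simpa [Nat.lt_succ_iff] using hk
  rw [Polynomial.aeval_monomial]
  have : U * (algebraMap R R⟦X⟧ (coeff k A) * (C b * X * U ^ 2) ^ k)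
      = C (coeff k A * b ^ k) * (X ^ k * U ^ (2 * k + 1)) := by
    rw [map_mul, map_pow, PowerSeries.algebraMap_apply, Algebra.algebraMap_self_apply]
    ring
  rw [this, coeff_C_mul, coeff_X_pow_mul', if_pos hk, hU, coeff_geometric_pow, hA,
    coeff_map, catalanSeries_coeff, show 2 * k + (n - k) = n + k by omega, eq_natCast]
  ring

theorem mk_catalanMoment_eq (b c : R) :
    mk (catalanMoment b c) = 1 + C c * X * mk (catalanMoment b c)
      + C b * X * mk (catalanMoment b c) ^ 2 := by
  have ha : HasSubst (C b * X * (mk fun i => c ^ i : R⟦X⟧) ^ 2) :=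
    HasSubst.of_constantCoeff_zero' (by simp)
  have hA := congrArg (fun f => substAlgHom ha (PowerSeries.map (Nat.castRingHom R) f))
    catalanSeries_sq_mul_X_add_one
  simp only [map_add, map_mul, map_pow, map_one, map_X, substAlgHom_X] at hA
  rw [mk_catalanMoment_eq_subst b c ha]
  generalize substAlgHom ha (PowerSeries.map (Nat.castRingHom R) catalanSeries) = A at hA ⊢
  have hU := geometric_mul_one_sub c
  generalize (mk fun i => c ^ i : R⟦X⟧) = U at hA hU ⊢
  linear_combination A * hU - hA

end PowerSeries

section MomentFunctional

open Polynomial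

variable {R : Type*} [CommRing R]

/-- The linear functional on polynomials with moments `m`. -/
noncomputable def momentFunctional (m : ℕ → R) : R[X] →ₗ[R] R :=
  Polynomial.lsum fun k => LinearMap.mulRight R (m k)

theorem momentFunctional_X_pow (m : ℕ → R) (n : ℕ) : momentFunctional m (X ^ n) = m n := by
  simp [momentFunctional, Polynomial.lsum_apply, ← monomial_one_right_eq_X_pow]

theorem momentFunctional_C_mul (m : ℕ → R) (a : R) (p : R[X]) :
    momentFunctional m (C a * p) = a * momentFunctional m p := by
  rw [← smul_eq_C_mul, map_smul, smul_eq_mul]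

theorem momentFunctional_eq_sum_range (m : ℕ → R) (p : R[X]) {n : ℕ} (hp : p.natDegree < n) :
    momentFunctional m p = ∑ k ∈ Finset.range n, p.coeff k * m k := by
  rw [momentFunctional, Polynomial.lsum_apply, Polynomial.sum_over_range' _ _ n hp]
  · simp
  · simp

variable {b c : R} {Q : ℕ → R[X]}

theorem momentFunctional_catalanMoment (h0 : Q 0 = 1) (h1 : Q 1 = X - C (b + c))
    (hQ : ∀ n, Q (n + 2) = (X - C (2 * b + c)) * Q (n + 1) - C (b * (b + c)) * Q n) (n : ℕ) :
    ∀ m, momentFunctional (catalanMoment b c) (X ^ m * Q n) =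
      PowerSeries.coeff m (PowerSeries.mk (catalanMoment b c) *
        (PowerSeries.C b * (PowerSeries.mk (catalanMoment b c) - 1)) ^ n) := by
  have hM := mk_catalanMoment_eq b c
  have hcoeff (n : ℕ) :
      PowerSeries.coeff n (PowerSeries.mk (catalanMoment b c)) = catalanMoment b c n :=
    PowerSeries.coeff_mk _ _
  generalize PowerSeries.mk (catalanMoment b c) = M at hM hcoeff ⊢
  induction n using Nat.twoStepInduction with
  | zero =>
    intro m
    rw [h0, mul_one, momentFunctional_X_pow, pow_zero, mul_one, hcoeff]
  | one =>
    intro m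
    have hX : PowerSeries.X * (M * (PowerSeries.C b * (M - 1)) ^ 1) =
        M - 1 - PowerSeries.C (b + c) * (PowerSeries.X * M) := by
      rw [map_add]
      linear_combination -hM
    have hX := congrArg (PowerSeries.coeff (m + 1)) hX
    rw [PowerSeries.coeff_succ_X_mul, map_sub, map_sub, PowerSeries.coeff_C_mul,
      PowerSeries.coeff_succ_X_mul, PowerSeries.coeff_one, if_neg m.succ_ne_zero, sub_zero,
      hcoeff, hcoeff] at hX
    rw [hX, h1, show (X : R[X]) ^ m * (X - C (b + c)) = X ^ (m + 1) - C (b + c) * X ^ m by ring,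
      map_sub, momentFunctional_C_mul, momentFunctional_X_pow, momentFunctional_X_pow]
  | more n ih ih' =>
    intro m
    set G := PowerSeries.C b * (M - 1) with hG
    have hX : PowerSeries.X * (M * G ^ (n + 2)) =
        M * G ^ (n + 1) - PowerSeries.C (2 * b + c) * (PowerSeries.X * (M * G ^ (n + 1)))
          - PowerSeries.C (b * (b + c)) * (PowerSeries.X * (M * G ^ n)) := by
      have hGX : PowerSeries.X * G ^ 2 = G - PowerSeries.C (2 * b + c) * (PowerSeries.X * G)
          - PowerSeries.C (b * (b + c)) * PowerSeries.X := by
        simp only [hG, map_add, map_mul, map_ofNat]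
        linear_combination -PowerSeries.C b * hM
      linear_combination M * G ^ n * hGX
    have hX := congrArg (PowerSeries.coeff (m + 1)) hX
    simp only [PowerSeries.coeff_succ_X_mul, map_sub, PowerSeries.coeff_C_mul] at hX
    rw [hX, hQ, show (X : R[X]) ^ m * ((X - C (2 * b + c)) * Q (n + 1) - C (b * (b + c)) * Q n) =
      X ^ (m + 1) * Q (n + 1) - C (2 * b + c) * (X ^ m * Q (n + 1))
        - C (b * (b + c)) * (X ^ m * Q n) by ring]
    simp only [map_sub, momentFunctional_C_mul, ih, ih']

theorem natDegree_le_and_coeff_self (h0 : Q 0 = 1) (h1 : Q 1 = X - C (b + c))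
    (hQ : ∀ n, Q (n + 2) = (X - C (2 * b + c)) * Q (n + 1) - C (b * (b + c)) * Q n) (n : ℕ) :
    (Q n).natDegree ≤ n ∧ (Q n).coeff n = 1 := by
  induction n using Nat.twoStepInduction with
  | zero => simp [h0]
  | one =>
    rw [h1]
    exact ⟨natDegree_X_sub_C_le _, by simp [coeff_X]⟩
  | more n ih ih' =>
    rw [hQ]
    constructor
    · refine (natDegree_sub_le _ _).trans (max_le ?_ ?_)
      · refine natDegree_mul_le.trans ?_
        have := natDegree_X_sub_C_le (2 * b + c)
        omega
      · refine (natDegree_C_mul_le _ _).trans ?_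
        omega
    · rw [sub_mul, coeff_sub, coeff_sub, coeff_X_mul, coeff_C_mul, coeff_C_mul, ih'.2,
        coeff_eq_zero_of_natDegree_lt (show (Q (n + 1)).natDegree < n + 2 by omega),
        coeff_eq_zero_of_natDegree_lt (show (Q n).natDegree < n + 2 by omega)]
      ring

end MomentFunctional

theorem eq_of_sum_unitriangular_eq {R : Type*} [CommRing R] {a : ℕ → ℕ → R} {u v : ℕ → R}
    (ha : ∀ n, a n n = 1)
    (h : ∀ n, ∑ k ∈ Finset.range (n + 1), a n k * u k = ∑ k ∈ Finset.range (n + 1), a n k * v k)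
    (n : ℕ) : u n = v n := by
  induction n using Nat.strong_induction_on with
  | _ n ih =>
    have hn := h n
    rw [Finset.sum_range_succ, Finset.sum_range_succ, ha, one_mul, one_mul,
      Finset.sum_congr rfl fun k hk => by rw [ih k (Finset.mem_range.mp hk)]] at hn
    exact add_left_cancel hn

/-- Closed form for the moments of the orthogonal polynomials `Q̃_n`:
`μ̃_n = ∑_{k=0}^n C(n+k, 2k) c^{n-k} b^k Catalan(k)`. -/
theorem tfraction_moment_closed_form
    (b c : ℝ) (hb : b ≠ 0) (hc : c ≠ 0)
    (Qt : ℕ → Polynomial ℝ)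
    (hQt0 : Qt 0 = 1)
    (hQt1 : Qt 1 = Polynomial.X - Polynomial.C (b + c))
    (hQt : ∀ n, 2 ≤ n →
      Qt n = (Polynomial.X - Polynomial.C (2 * b + c)) * Qt (n - 1)
             - Polynomial.C (b * (b + c)) * Qt (n - 2))
    (μt : ℕ → ℝ)
    (hμt : ∀ n, (∑ k ∈ Finset.range (n + 1), (Qt n).coeff k * μt k) =
      if n = 0 then 1 else 0)
    (n : ℕ) :
    μt n = ∑ k ∈ Finset.range (n + 1),
      ((n + k).choose (2 * k) : ℝ) * c ^ (n - k) * b ^ k * (catalan k : ℝ) := by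
  have hQ (n : ℕ) : Qt (n + 2) = (Polynomial.X - Polynomial.C (2 * b + c)) * Qt (n + 1)
      - Polynomial.C (b * (b + c)) * Qt n := hQt (n + 2) (Nat.le_add_left 2 n)
  have hdeg := natDegree_le_and_coeff_self hQt0 hQt1 hQ
  refine eq_of_sum_unitriangular_eq (v := catalanMoment b c) (fun n => (hdeg n).2) (fun n => ?_) n
  rw [hμt, ← momentFunctional_eq_sum_range _ _ (Nat.lt_succ_of_le (hdeg n).1)]
  have h := momentFunctional_catalanMoment hQt0 hQt1 hQ n 0
  rw [pow_zero, one_mul] at h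
  rw [h]
  rcases eq_or_ne n 0 with rfl | hn
  · simp [catalanMoment]
  · simp [catalanMoment, hn]
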